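/- Let R = k[x,y,z] and, for an integer m ≥ 1, let φ be the 3×2 matrix with columns (x^m, y^m, 0)ᵗ and (p_1, p_2, p_3)ᵗ, where: (a) p_1,p_2,p_3 are forms of degree n+ε for some 1 ≤ n ≤ m and ε ≥ max{m−n, 1}; (b) I = I₂(φ) has height 2; (c) the (x,y)-primary component of the ideal of entries I₁(φ) is (x^m, y^n); and (d) if m = n, then either the minor Δ = x^m p_2 − y^m p_1 or p_3 has z-degree ε. Then the Rees algebra R(I) of I is Cohen–Macaulay, and its bihomogeneous defining ideal in R[t_1,t_2,t_3] is generated by the two defining relations f, g of the symmetric algebra of I (induced by the columns of φ) together with one determinantal (Sylvester) form h of bidegree (ε, 2); explicitly, writing p_i = q_i x^m + q'_i y^n, the defining ideal is the ideal of 2-minors of the 3×2 matrix with rows (t_1, t_2 y^{m−n}), (Σ q_i t_i, Σ q'_i t_i), (−y^n, x^m), and this ideal is prime of height 2. -/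

import Mathlib

set_option synthInstance.maxHeartbeats 1000000
set_option maxHeartbeats 1000000

open Matrix MvPolynomial

noncomputable section

def idealHeight {A : Type*} [CommRing A] (I : Ideal A) : ℕ∞ :=
  ⨅ (P : PrimeSpectrum A) (_ : I ≤ P.asIdeal), Order.height P

def minorsIdeal {A : Type*} [CommRing A] {p q : ℕ} (t : ℕ)
    (M : Matrix (Fin p) (Fin q) A) : Ideal A :=
  Ideal.span { x | ∃ (r : Fin t → Fin p) (c : Fin t → Fin q),
    Function.Injective r ∧ Function.Injective c ∧ x = (M.submatrix r c).det }

/-- Condition `G_s` of Artin–Nagata: for every prime `P ⊇ L` with `ht P ≤ s − 1`,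
the localization `L_P` can be generated by at most `ht P` elements. -/
def CondG {A : Type*} [CommRing A] (L : Ideal A) (s : ℕ) : Prop :=
  ∀ P : Ideal A, P.IsPrime → L ≤ P → idealHeight P + 1 ≤ (s : ℕ∞) →
    ∃ c : ℕ, (c : ℕ∞) ≤ idealHeight P ∧ ∃ g : Fin c → A, (∀ i, g i ∈ L) ∧
      ∀ x ∈ L, ∃ u ∉ P, u * x ∈ Ideal.span (Set.range g)

/-- The skew-symmetric matrix of signed `m × m` minors (obtained by omitting two columns)
of an `m × (m+2)` matrix; this is the middle differential of the Buchsbaum–Rim complex. -/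
def bbrim {A : Type*} [CommRing A] {m : ℕ} (ψ : Matrix (Fin m) (Fin (m + 2)) A) :
    Matrix (Fin (m + 2)) (Fin (m + 2)) A :=
  Matrix.of fun i j =>
    if h : (i : ℕ) < (j : ℕ) then
      (-1) ^ ((i : ℕ) + (j : ℕ)) *
        (ψ.submatrix id (fun q => j.succAbove
          ((⟨(i : ℕ), by have := j.isLt; omega⟩ : Fin (m + 1)).succAbove q))).det
    else if h' : (j : ℕ) < (i : ℕ) then
      (-1) ^ ((i : ℕ) + (j : ℕ) + 1) *
        (ψ.submatrix id (fun q => i.succAbove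
          ((⟨(j : ℕ), by have := i.isLt; omega⟩ : Fin (m + 1)).succAbove q))).det
    else 0

def rowMap {A : Type*} [CommRing A] {ι : Type*} [Fintype ι] (g : ι → A) :
    (ι → A) →ₗ[A] A :=
  ∑ i, g i • LinearMap.proj i

/-- Data of a (necessarily minimal) graded free resolution
`0 → ⊕_j R(−a_j) → ⊕_i R(−b_i) → I → 0` of an ideal of a polynomial ring. -/
def HasResolutionData {A : Type*} [CommRing A] {σ : Type*} (I : Ideal (MvPolynomial σ A))
    {N M : ℕ} (b : Fin N → ℕ) (a : Fin M → ℕ) : Prop :=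
  ∃ (g : Fin N → MvPolynomial σ A) (φ : Matrix (Fin N) (Fin M) (MvPolynomial σ A)),
    (∀ i, (g i).IsHomogeneous (b i)) ∧ Ideal.span (Set.range g) = I ∧
    (∀ i j, (φ i j).IsHomogeneous (a j - b i) ∧ (a j ≤ b i → φ i j = 0)) ∧
    Function.Injective φ.mulVecLin ∧
    LinearMap.range φ.mulVecLin = LinearMap.ker (rowMap g)

/-- The Castelnuovo–Mumford regularity of a codimension-two perfect ideal, read off from
its minimal graded free resolution `0 → ⊕_j R(−a_j) → ⊕_i R(−b_i) → I → 0` as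
`max(max_i b_i, max_j a_j − 1)`. -/
def HasRegularity {A : Type*} [CommRing A] {σ : Type*} (I : Ideal (MvPolynomial σ A))
    (r : ℕ) : Prop :=
  ∃ (N M : ℕ) (b : Fin N → ℕ) (a : Fin M → ℕ), HasResolutionData I b a ∧
    (Finset.univ.sup b) ⊔ ((Finset.univ.sup a) - 1) = r

def IsCohenMacaulayRing (A : Type*) [CommRing A] : Prop :=
  ∀ P : Ideal A, P.IsMaximal → ∃ rs : List A,
    (∀ x ∈ rs, x ∈ P) ∧ RingTheory.Sequence.IsRegular A rs ∧
      (rs.length : ℕ∞) = idealHeight P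

def reesPresentation {A : Type*} [CommRing A] {n : ℕ} (f : Fin n → A) :
    MvPolynomial (Fin n) A →ₐ[A] Polynomial A :=
  MvPolynomial.aeval fun i => Polynomial.C (f i) * Polynomial.X

def Ideal.IsLinearType {A : Type*} [CommRing A] (I : Ideal A) : Prop :=
  ∀ (n : ℕ) (f : Fin n → A), Ideal.span (Set.range f) = I →
    RingHom.ker (reesPresentation f) =
      Ideal.span {p | p ∈ RingHom.ker (reesPresentation f) ∧ p.IsHomogeneous 1}

def moduleDepth {A : Type*} [CommRing A] (J : Ideal A) (M : Type*)
    [AddCommGroup M] [Module A M] : ℕ∞ :=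
  sSup {c : ℕ∞ | ∃ rs : List A, (∀ x ∈ rs, x ∈ J) ∧
    RingTheory.Sequence.IsRegular M rs ∧ (rs.length : ℕ∞) = c}

def analyticSpread {A : Type*} [CommRing A] (m I : Ideal A) : WithBot ℕ∞ :=
  ringKrullDim ((reesAlgebra I) ⧸ (Ideal.map (algebraMap A (reesAlgebra I)) m))

section Points

variable {k : Type*} [Field k]

def gradedPiece (I : Ideal (MvPolynomial (Fin 3) k)) (t : ℕ) :
    Submodule k (MvPolynomial (Fin 3) k) :=
  Submodule.restrictScalars k I ⊓ homogeneousSubmodule (Fin 3) k t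

def pointIdeal (p : Fin 3 → k) : Ideal (MvPolynomial (Fin 3) k) :=
  Ideal.span {f | f.IsHomogeneous 1 ∧ MvPolynomial.eval p f = 0}

def vanishingIdeal {n : ℕ} (pts : Fin n → (Fin 3 → k)) : Ideal (MvPolynomial (Fin 3) k) :=
  ⨅ i, pointIdeal (pts i)

def oneTimesPiece (I : Ideal (MvPolynomial (Fin 3) k)) (s : ℕ) :
    Submodule k (MvPolynomial (Fin 3) k) :=
  Submodule.span k {g | ∃ ℓ f, ℓ ∈ homogeneousSubmodule (Fin 3) k 1 ∧
    f ∈ gradedPiece I s ∧ g = ℓ * f}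

def IsPointFamily {n : ℕ} (pts : Fin n → (Fin 3 → k)) : Prop :=
  (∀ i, pts i ≠ 0) ∧ ∀ i j, i ≠ j → ∀ c : k, pts i ≠ c • pts j

def InGenericPosition {n : ℕ} (pts : Fin n → (Fin 3 → k)) : Prop :=
  ∀ t : ℕ, Module.finrank k (gradedPiece (vanishingIdeal pts) t) = (t + 2).choose 2 - n

def InUniformPosition {n : ℕ} (pts : Fin n → (Fin 3 → k)) : Prop :=
  ∀ T : Finset (Fin n), ∀ t : ℕ,
    Module.finrank k (gradedPiece (⨅ i ∈ T, pointIdeal (pts i)) t) = (t + 2).choose 2 - T.card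

def HasInitialDegree (I : Ideal (MvPolynomial (Fin 3) k)) (s : ℕ) : Prop :=
  gradedPiece I s ≠ ⊥ ∧ ∀ t < s, gradedPiece I t = ⊥

def InTightGenericPosition {n : ℕ} (pts : Fin n → (Fin 3 → k)) (s : ℕ) : Prop :=
  InGenericPosition pts ∧
    Module.finrank k (oneTimesPiece (vanishingIdeal pts) s) =
      min (3 * Module.finrank k (gradedPiece (vanishingIdeal pts) s))
        (Module.finrank k (gradedPiece (vanishingIdeal pts) (s + 1)))

def IsBirationalOntoImage {N : ℕ} (f : Fin N → MvPolynomial (Fin 3) k) : Prop :=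
  ∃ (e : ℕ) (G : Fin 3 → MvPolynomial (Fin N) k) (w : MvPolynomial (Fin 3) k),
    w ≠ 0 ∧ (∀ j, (G j).IsHomogeneous e) ∧
      ∀ j, MvPolynomial.aeval f (G j) = w * MvPolynomial.X j

end Points

end

section HilbertBurch

variable {D : Type*} [CommRing D] [IsDomain D]

/-- Over a factorial domain, a vector proportional to a vector whose entries have no common
prime factor is a multiple of it. -/
lemma exists_eq_smul_of_proportional [UniqueFactorizationMonoid D] {d e : Fin 3 → D}
    (hed : ∀ i j, e i * d j = e j * d i) (hd : ∃ i, d i ≠ 0)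
    (hprime : ∀ π : D, Prime π → ∃ i, ¬ π ∣ d i) : ∃ c : D, e = c • d := by
  classical
  let := UniqueFactorizationMonoid.toGCDMonoid D
  have hunit : IsUnit (gcd (d 0) (gcd (d 1) (d 2))) := by
    by_contra hu
    have hne : gcd (d 0) (gcd (d 1) (d 2)) ≠ 0 := by
      intro h
      simp only [gcd_eq_zero_iff] at h
      obtain ⟨i, hi⟩ := hd
      fin_cases i <;> simp_all
    obtain ⟨π, hπ, hdvd⟩ := WfDvdMonoid.exists_irreducible_factor hu hne
    obtain ⟨i, hi⟩ := hprime π (UniqueFactorizationMonoid.irreducible_iff_prime.mp hπ)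
    apply hi
    fin_cases i
    · exact hdvd.trans (gcd_dvd_left _ _)
    · exact hdvd.trans ((gcd_dvd_right _ _).trans (gcd_dvd_left _ _))
    · exact hdvd.trans ((gcd_dvd_right _ _).trans (gcd_dvd_right _ _))
  obtain ⟨i, hi⟩ := hd
  have key : ∀ j, d i ∣ e i * d j := fun j => ⟨e j, by rw [hed i j, mul_comm]⟩
  have h1 : d i ∣ e i * gcd (d 0) (gcd (d 1) (d 2)) :=
    (dvd_gcd (key 0) ((dvd_gcd (key 1) (key 2)).trans
      (gcd_mul_left' (e i) (d 1) (d 2)).dvd)).trans (gcd_mul_left' (e i) _ _).dvd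
  obtain ⟨c, hc⟩ := (hunit.dvd_mul_right).mp h1
  refine ⟨c, funext fun j => mul_right_cancel₀ hi ?_⟩
  rw [Pi.smul_apply, smul_eq_mul, hed j i, hc]
  ring

/-- A vector with vanishing cross product with both `a` and `b` is zero when `a` and `b`
are independent. -/
lemma eq_zero_of_cross_eq_zero {a b w : Fin 3 → D} (hab : crossProduct a b ≠ 0)
    (ha : crossProduct a w = 0) (hb : crossProduct w b = 0) : w = 0 := by
  obtain ⟨i, hi⟩ := Function.ne_iff.mp hab
  have key : ∀ j, crossProduct a b i * w j = 0 := by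
    have h (j) := congrFun ha j
    have h' (j) := congrFun hb j
    have h1 := h 0
    have h2 := h 1
    have h3 := h 2
    have h4 := h' 0
    have h5 := h' 1
    have h6 := h' 2
    simp [cross_apply, -mul_eq_zero] at h1 h2 h3 h4 h5 h6
    intro j
    fin_cases i <;> fin_cases j <;> simp [cross_apply, -mul_eq_zero] <;> grind
  exact funext fun j => (mul_eq_zero.mp (key j)).resolve_left hi

/-- The Hilbert–Burch theorem for `3 × 2` matrices over a factorial domain: the syzygies of the
maximal minors are generated by the columns, if the minors have no common prime factor. -/
lemma exists_combination_of_syzygy [UniqueFactorizationMonoid D] {a b v : Fin 3 → D}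
    (hab : crossProduct a b ≠ 0)
    (hprime : ∀ π : D, Prime π → ∃ i, ¬ π ∣ crossProduct a b i)
    (hv : v ⬝ᵥ crossProduct a b = 0) : ∃ c₁ c₂ : D, v = c₁ • a + c₂ • b := by
  have hv' : v 0 * (a 1 * b 2 - a 2 * b 1) + v 1 * (a 2 * b 0 - a 0 * b 2)
      + v 2 * (a 0 * b 1 - a 1 * b 0) = 0 := by
    simpa [cross_apply, dotProduct, Fin.sum_univ_three] using hv
  have hne := Function.ne_iff.mp hab
  obtain ⟨c₁, h₁⟩ := exists_eq_smul_of_proportional (e := crossProduct v b)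
    (d := crossProduct a b) (by
      intro i j
      fin_cases i <;> fin_cases j <;> simp [cross_apply] <;> grind) hne hprime
  obtain ⟨c₂, h₂⟩ := exists_eq_smul_of_proportional (e := crossProduct a v)
    (d := crossProduct a b) (by
      intro i j
      fin_cases i <;> fin_cases j <;> simp [cross_apply] <;> grind) hne hprime
  refine ⟨c₁, c₂, sub_eq_zero.mp (eq_zero_of_cross_eq_zero hab ?_ ?_)⟩
  · simp [h₂]
  · simp [h₁]

end HilbertBurch

section RegularSequences

open RingTheory.Sequence

/-- Every maximal ideal of `S` contains a weakly `S`-regular sequence of length `n`. -/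
def HasLongRegularSequences (S : Type*) [CommRing S] (n : ℕ) : Prop :=
  ∀ Q : Ideal S, Q.IsMaximal → ∃ rs : List S,
    rs.length = n ∧ (∀ r ∈ rs, r ∈ Q) ∧ IsWeaklyRegular S rs

lemma HasLongRegularSequences.of_ringEquiv {S T : Type*} [CommRing S] [CommRing T] {n : ℕ}
    (h : HasLongRegularSequences S n) (e : S ≃+* T) : HasLongRegularSequences T n := by
  intro Q hQ
  obtain ⟨rs, hlen, hmem, hreg⟩ := h (Q.comap (e : S →+* T))
    (Ideal.comap_isMaximal_of_surjective (e : S →+* T) e.surjective)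
  refine ⟨rs.map e, by simpa using hlen, ?_, ?_⟩
  · intro r hr
    obtain ⟨s, hs, rfl⟩ := List.mem_map.mp hr
    exact hmem s hs
  · refine (AddEquiv.isWeaklyRegular_congr (e := e.toAddEquiv) ?_).mp hreg
    rw [List.forall₂_map_right_iff, List.forall₂_same]
    intro r _ x
    simp

lemma isSMulRegular_quotient_map_C_of_monic {S : Type*} [CommRing S] (I : Ideal S)
    {F : Polynomial S} (hF : F.Monic) :
    IsSMulRegular (Polynomial S ⧸ I.map Polynomial.C) F := by
  rw [isSMulRegular_quotient_iff_mem_of_smul_mem]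
  intro G hG
  have hmem : ∀ H : Polynomial S, H ∈ I.map Polynomial.C ↔
      H.map (Ideal.Quotient.mk I) = 0 := by
    intro H
    rw [Ideal.mem_map_C_iff, Polynomial.ext_iff]
    simp [Polynomial.coeff_map, Ideal.Quotient.eq_zero_iff_mem]
  rw [hmem] at hG ⊢
  rw [smul_eq_mul, Polynomial.map_mul] at hG
  exact (hF.map (Ideal.Quotient.mk I)).isRegular.left (by simpa using hG)

lemma HasLongRegularSequences.polynomial {S : Type*} [CommRing S] [IsJacobsonRing S] {n : ℕ}
    (h : HasLongRegularSequences S n) : HasLongRegularSequences (Polynomial S) (n + 1) := by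
  intro Q hQ
  obtain ⟨rs, hlen, hmem, hreg⟩ := h _ (Polynomial.isMaximal_comap_C_of_isJacobsonRing Q)
  obtain ⟨F, hF, hF0⟩ := Polynomial.quotient_mk_comp_C_isIntegral_of_isJacobsonRing Q
    (Ideal.Quotient.mk Q Polynomial.X)
  refine ⟨rs.map Polynomial.C ++ [F], by simpa using hlen, ?_, ?_⟩
  · intro r hr
    rcases List.mem_append.mp hr with hr | hr
    · obtain ⟨s, hs, rfl⟩ := List.mem_map.mp hr
      exact hmem s hs
    · rw [List.mem_singleton.mp hr, ← Ideal.Quotient.eq_zero_iff_mem, ← hF0,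
        ← Polynomial.hom_eval₂, Polynomial.eval₂_C_X]
  · refine (isWeaklyRegular_append_iff _ _ _).mpr ⟨hreg.of_flat (S := Polynomial S), ?_⟩
    rw [isWeaklyRegular_singleton_iff]
    have := isSMulRegular_quotient_map_C_of_monic (Ideal.ofList rs) hF
    rw [Ideal.map_ofList] at this
    rw [smul_eq_mul, Ideal.mul_top]
    exact this

lemma HasLongRegularSequences.mvPolynomial {S : Type*} [CommRing S] [IsJacobsonRing S] {n : ℕ}
    (h : HasLongRegularSequences S n) (m : ℕ) :
    HasLongRegularSequences (MvPolynomial (Fin m) S) (n + m) := by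
  induction m with
  | zero => exact h.of_ringEquiv (MvPolynomial.isEmptyAlgEquiv S (Fin 0)).symm.toRingEquiv
  | succ m ih =>
    exact ih.polynomial.of_ringEquiv (MvPolynomial.finSuccEquiv S m).symm.toRingEquiv

lemma hasLongRegularSequences_zero (S : Type*) [CommRing S] : HasLongRegularSequences S 0 :=
  fun _ _ => ⟨[], rfl, by simp, by simp⟩

end RegularSequences

section Height

lemma idealHeight_le_height {A : Type*} [CommRing A] {I P : Ideal A} [hP : P.IsPrime]
    (h : I ≤ P) : idealHeight I ≤ P.height := by
  exact (iInf₂_le (⟨P, hP⟩ : PrimeSpectrum A) h).trans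
    (PrimeSpectrum.height_eq_orderHeight ⟨P, hP⟩).ge

lemma idealHeight_eq_height {A : Type*} [CommRing A] (P : Ideal A) [hP : P.IsPrime] :
    idealHeight P = P.height := by
  refine le_antisymm (idealHeight_le_height le_rfl) (le_iInf₂ fun Q hQ => ?_)
  rw [← PrimeSpectrum.height_eq_orderHeight]
  exact Ideal.height_mono hQ

end Height

section Depth

open RingTheory.Sequence CategoryTheory Abelian

universe u

variable {B : Type u} [CommRing B]

lemma subsingleton_ext_X₃ {X : ModuleCat.{u} B} {S : ShortComplex (ModuleCat.{u} B)}
    (hS : S.ShortExact) (i : ℕ) (h₂ : Subsingleton (Ext X S.X₂ i))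
    (h₁ : Subsingleton (Ext X S.X₁ (i + 1))) : Subsingleton (Ext X S.X₃ i) := by
  refine ⟨fun a b => ?_⟩
  have h : ∀ a : Ext X S.X₃ i, a = 0 := by
    intro a
    obtain ⟨c, rfl⟩ := Ext.covariant_sequence_exact₃ X hS a rfl (Subsingleton.elim _ _)
    rw [Subsingleton.elim c 0, Ext.zero_comp]
  rw [h a, h b]

lemma HasLongRegularSequences.subsingleton_ext_pi [IsNoetherianRing B] {N r : ℕ}
    (hB : HasLongRegularSequences B N) (hr : r ≠ 0) (Q : Ideal B) [hQ : Q.IsMaximal] (i : ℕ)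
    (hi : i < N) :
    Subsingleton (Ext (ModuleCat.of B (B ⧸ Q)) (ModuleCat.of B (Fin r → B)) i) := by
  obtain ⟨rs, rfl, hmem, hreg⟩ := hB Q hQ
  have hlt : Q • (⊤ : Submodule B (Fin r → B)) < ⊤ := by
    refine lt_of_le_of_lt (b := Submodule.comap (LinearMap.proj ⟨0, Nat.pos_of_ne_zero hr⟩) Q)
      ?_ ?_
    · refine Submodule.smul_le.mpr fun a ha v _ => ?_
      exact Q.mul_mem_right _ ha
    · refine lt_top_iff_ne_top.mpr fun h => hQ.ne_top ((Ideal.eq_top_iff_one Q).mpr ?_)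
      have : (fun _ => 1 : Fin r → B) ∈
          Submodule.comap (LinearMap.proj ⟨0, Nat.pos_of_ne_zero hr⟩) Q := h ▸ Submodule.mem_top
      exact this
  refine ModuleCat.subsingleton_ext_of_exists_isRegular Q (ModuleCat.of B (B ⧸ Q)) ?_
    (ModuleCat.of B (Fin r → B)) hlt rs hmem ?_ i hi
  · rw [Module.support_eq_zeroLocus]
    simp [Ideal.annihilator_quotient]
  · refine ⟨?_, ?_⟩
    · exact (LinearEquiv.isWeaklyRegular_congr
        (TensorProduct.piScalarRight B B B (Fin r)) rs).mp hreg.isWeaklyRegular_rTensor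
    · intro h
      refine hlt.ne (top_le_iff.mp (h.le.trans (Submodule.smul_mono_left ?_)))
      exact Ideal.span_le.mpr hmem

/-- A quotient of a ring with long regular sequences by an ideal with a length one resolution
has long regular sequences. -/
lemma HasLongRegularSequences.quotient_of_resolution [IsNoetherianRing B] {N r s : ℕ}
    (hB : HasLongRegularSequences B (N + 2)) (hr : r ≠ 0) (hs : s ≠ 0) {J : Ideal B}
    (F : (Fin r → B) →ₗ[B] (Fin s → B)) (G : (Fin s → B) →ₗ[B] J)
    (hF : Function.Injective F) (hFG : Function.Exact F G) (hG : Function.Surjective G) :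
    HasLongRegularSequences (B ⧸ J) N := by
  intro P hP
  let Q : Ideal B := P.comap (Ideal.Quotient.mk J)
  have hQ : Q.IsMaximal := Ideal.comap_isMaximal_of_surjective _ Ideal.Quotient.mk_surjective
  have hJQ : J ≤ Q := by
    intro j hj
    change Ideal.Quotient.mk J j ∈ P
    rw [Ideal.Quotient.eq_zero_iff_mem.mpr hj]
    exact P.zero_mem
  have hmod : ∀ {t : ℕ}, t ≠ 0 → ∀ i < N + 2,
      Subsingleton (Ext (ModuleCat.of B (B ⧸ Q)) (ModuleCat.of B (Fin t → B)) i) :=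
    fun ht i hi => hB.subsingleton_ext_pi ht Q i hi
  have hS₁ : (ModuleCat.shortComplexOfCompEqZero F G hFG.linearMap_comp_eq_zero).ShortExact :=
    ModuleCat.shortComplex_shortExact _ hFG hF hG
  have hJ : ∀ i < N + 1, Subsingleton (Ext (ModuleCat.of B (B ⧸ Q)) (ModuleCat.of B J) i) :=
    fun i hi => subsingleton_ext_X₃ hS₁ i (hmod hs i (by omega)) (hmod hr (i + 1) (by omega))
  have hex : Function.Exact (LinearMap.pi fun _ : Fin 1 => J.subtype)
      (J.mkQ.comp (LinearMap.proj 0 : (Fin 1 → B) →ₗ[B] B)) := by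
    intro v
    simp only [LinearMap.comp_apply, LinearMap.proj_apply, Submodule.mkQ_apply,
      Submodule.Quotient.mk_eq_zero]
    constructor
    · intro hv
      refine ⟨⟨v 0, hv⟩, funext fun i => ?_⟩
      rw [Subsingleton.elim i 0]
      rfl
    · rintro ⟨j, rfl⟩
      exact j.2
  have hS₂ := ModuleCat.shortComplex_shortExact
    (ModuleCat.shortComplexOfCompEqZero _ _ hex.linearMap_comp_eq_zero) hex
    (fun a b hab => Subtype.ext (congrFun hab 0))
    (fun c => by
      obtain ⟨b, rfl⟩ := J.mkQ_surjective c
      exact ⟨fun _ => b, rfl⟩)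
  have hlt : Q • (⊤ : Submodule B (B ⧸ J)) < ⊤ := by
    refine lt_of_le_of_lt (b := P.restrictScalars B) ?_ ?_
    · refine Submodule.smul_le.mpr fun a ha c _ => ?_
      exact P.mul_mem_right c ha
    · refine lt_top_iff_ne_top.mpr fun h => hP.ne_top ((Ideal.eq_top_iff_one P).mpr ?_)
      have : (1 : B ⧸ J) ∈ P.restrictScalars B := h ▸ Submodule.mem_top
      exact this
  obtain ⟨rs, hlen, hmem, hreg⟩ := ModuleCat.exists_isRegular_of_exists_subsingleton_ext Q N
    (ModuleCat.of B (B ⧸ J)) hlt (ModuleCat.of B (B ⧸ Q))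
    (by
      rw [Module.support_eq_zeroLocus]
      simp [Ideal.annihilator_quotient])
    (fun i hi => subsingleton_ext_X₃ hS₂ i (hmod one_ne_zero i (by omega)) (hJ (i + 1) (by omega)))
  refine ⟨rs.map (Ideal.Quotient.mk J), by simpa using hlen, ?_, ?_⟩
  · intro a ha
    obtain ⟨b, hb, rfl⟩ := List.mem_map.mp ha
    exact hmem b hb
  · exact (isWeaklyRegular_map_algebraMap_iff (B ⧸ J) (B ⧸ J) rs).mpr hreg.toIsWeaklyRegular

/-- A Noetherian ring of dimension at most `N`, all of whose maximal ideals contain weakly regular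
sequences of length `N`, is Cohen–Macaulay. -/
lemma HasLongRegularSequences.isCohenMacaulayRing [IsNoetherianRing B] {N : ℕ}
    (hB : HasLongRegularSequences B N) (hdim : ringKrullDim B ≤ N) : IsCohenMacaulayRing B := by
  intro P hP
  obtain ⟨rs, rfl, hmem, hreg⟩ := hB P hP
  refine ⟨rs, hmem, ⟨hreg, ?_⟩, ?_⟩
  · intro h
    rw [smul_eq_mul, Ideal.mul_top] at h
    exact hP.ne_top (top_le_iff.mp (h.le.trans (Ideal.span_le.mpr hmem)))
  · rw [idealHeight_eq_height]
    refine le_antisymm ?_ ?_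
    · have hloc := hreg.isRegular_of_isLocalization_of_mem (Localization.AtPrime P) P hmem
      have h := ringKrullDim_add_length_eq_ringKrullDim_of_isRegular _ hloc
      rw [IsLocalization.AtPrime.ringKrullDim_eq_height P (Localization.AtPrime P),
        List.length_map] at h
      have : Nontrivial (Localization.AtPrime P ⧸
          Ideal.ofList (rs.map (algebraMap B (Localization.AtPrime P)))) := by
        refine Ideal.Quotient.nontrivial_iff.mpr fun htop => hloc.top_ne_smul ?_
        rw [htop, smul_eq_mul, Ideal.mul_top]
      have h0 := ringKrullDim_nonneg_of_nontrivial (R := Localization.AtPrime P ⧸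
          Ideal.ofList (rs.map (algebraMap B (Localization.AtPrime P))))
      have : ((rs.length : ℕ∞) : WithBot ℕ∞) ≤ (P.height : WithBot ℕ∞) := by
        rw [← h]
        simpa using add_le_add_left h0 (rs.length : WithBot ℕ∞)
      exact WithBot.coe_le_coe.mp this
    · exact WithBot.coe_le_coe.mp ((Ideal.height_le_ringKrullDim_of_isPrime (I := P)).trans hdim)

end Depth

section MaximalMinors

/-- The ideal of maximal minors of a `3 × 2` matrix is generated by the entries of the
cross product of its columns. -/
lemma minorsIdeal_two_eq_span_cross {A : Type*} [CommRing A] (M : Matrix (Fin 3) (Fin 2) A) :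
    minorsIdeal 2 M = Ideal.span (Set.range (crossProduct (M.col 0) (M.col 1))) := by
  refine le_antisymm (Ideal.span_le.mpr ?_) (Ideal.span_le.mpr ?_)
  · rintro _ ⟨r, c, -, -, rfl⟩
    have h (i : Fin 3) : crossProduct (M.col 0) (M.col 1) i ∈
        Ideal.span (Set.range (crossProduct (M.col 0) (M.col 1))) :=
      Ideal.subset_span ⟨i, rfl⟩
    rw [SetLike.mem_coe]
    generalize Ideal.span (Set.range (crossProduct (M.col 0) (M.col 1))) = L at h
    have h0 : M 1 0 * M 2 1 - M 2 0 * M 1 1 ∈ L := h 0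
    have h1 : M 2 0 * M 0 1 - M 0 0 * M 2 1 ∈ L := h 1
    have h2 : M 0 0 * M 1 1 - M 1 0 * M 0 1 ∈ L := h 2
    have key : ∀ r₀ r₁ : Fin 3, M r₀ 0 * M r₁ 1 - M r₁ 0 * M r₀ 1 ∈ L := by
      intro r₀ r₁
      fin_cases r₀ <;> fin_cases r₁ <;> dsimp only [Fin.reduceFinMk, Fin.zero_eta, Fin.mk_one] <;>
        first
        | exact (sub_self (_ : A)).symm ▸ L.zero_mem
        | assumption
        | exact neg_sub (_ : A) _ ▸ L.neg_mem ‹_›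
    rw [Matrix.det_fin_two]
    simp only [Matrix.submatrix_apply]
    generalize c 0 = c₀
    generalize c 1 = c₁
    fin_cases c₀ <;> fin_cases c₁ <;> dsimp only [Fin.reduceFinMk, Fin.zero_eta, Fin.mk_one]
    · rw [mul_comm, sub_self]
      exact L.zero_mem
    · rw [mul_comm (M (r 0) 1)]
      exact key _ _
    · rw [mul_comm (M (r 0) 1), ← neg_sub]
      exact L.neg_mem (key _ _)
    · rw [mul_comm, sub_self]
      exact L.zero_mem
  · have hinj : Function.Injective (![0, 1] : Fin 2 → Fin 2) := by decide
    have hmem : ∀ r : Fin 2 → Fin 3, Function.Injective r →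
        M (r 0) 0 * M (r 1) 1 - M (r 1) 0 * M (r 0) 1 ∈ minorsIdeal 2 M := by
      intro r hr
      refine Ideal.subset_span ⟨r, ![0, 1], hr, hinj, ?_⟩
      simp [Matrix.det_fin_two, mul_comm (M (r 0) 1)]
    rintro _ ⟨i, rfl⟩
    fin_cases i
    · exact hmem ![1, 2] (by decide)
    · exact hmem ![2, 0] (by decide)
    · exact hmem ![0, 1] (by decide)

universe u

lemma HasLongRegularSequences.quotient_span_cross {B : Type u} [CommRing B] [IsDomain B]
    [UniqueFactorizationMonoid B] [IsNoetherianRing B] {N : ℕ}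
    (hB : HasLongRegularSequences B (N + 2)) {a b : Fin 3 → B} (hab : crossProduct a b ≠ 0)
    (hprime : ∀ π : B, Prime π → ∃ i, ¬ π ∣ crossProduct a b i) :
    HasLongRegularSequences (B ⧸ Ideal.span (Set.range (crossProduct a b))) N := by
  let J := Ideal.span (Set.range (crossProduct a b))
  let F : (Fin 2 → B) →ₗ[B] (Fin 3 → B) := Fintype.linearCombination B ![a, b]
  let G' : (Fin 3 → B) →ₗ[B] B := Fintype.linearCombination B (crossProduct a b)
  have hF' (c : Fin 2 → B) : F c = c 0 • a + c 1 • b := by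
    simp [F, Fintype.linearCombination_apply, Fin.sum_univ_two]
  have hG' (v : Fin 3 → B) : G' v = v ⬝ᵥ crossProduct a b := by
    simp [G', Fintype.linearCombination_apply, dotProduct]
  have hrange : LinearMap.range G' = J := Fintype.range_linearCombination B _
  let G : (Fin 3 → B) →ₗ[B] J := G'.codRestrict J fun v => hrange ▸ LinearMap.mem_range_self G' v
  refine hB.quotient_of_resolution two_ne_zero three_ne_zero F G ?_ ?_ ?_
  · rw [← LinearMap.ker_eq_bot, LinearMap.ker_eq_bot']
    intro c hc
    rw [hF'] at hc
    have h0 : c 0 • crossProduct a b = 0 := by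
      have := congrArg (fun v => crossProduct v b) hc
      simpa using this
    have h1 : c 1 • crossProduct a b = 0 := by
      have := congrArg (fun v => crossProduct a v) hc
      simpa using this
    ext i
    fin_cases i
    · exact (smul_eq_zero.mp h0).resolve_right hab
    · exact (smul_eq_zero.mp h1).resolve_right hab
  · intro v
    have : G v = 0 ↔ v ⬝ᵥ crossProduct a b = 0 := by
      rw [← hG', ← Submodule.coe_eq_zero]
      rfl
    rw [this]
    constructor
    · intro hv
      obtain ⟨c₁, c₂, rfl⟩ := exists_combination_of_syzygy hab hprime hv
      exact ⟨![c₁, c₂], by simp [hF']⟩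
    · rintro ⟨c, rfl⟩
      rw [hF']
      simp
  · rintro ⟨j, hj⟩
    obtain ⟨v, rfl⟩ := LinearMap.mem_range.mp (hrange ▸ hj : j ∈ LinearMap.range G')
    exact ⟨v, rfl⟩

end MaximalMinors

section Elimination

variable {R : Type*} [CommRing R]

/-- The linear form with coefficients `p`. -/
noncomputable def linearForm (p : Fin 3 → R) : MvPolynomial (Fin 3) R :=
  ∑ i, C (p i) * X i

/-- The signed maximal minors of the matrix with columns `(a, b, 0)` and `p`. -/
def signedMinors (a b : R) (p : Fin 3 → R) : Fin 3 → R :=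
  ![b * p 2, -(a * p 2), a * p 1 - b * p 0]

/-- If every generator of an algebra becomes, after multiplication by `c`, congruent modulo `I` to
an element of the subalgebra `D`, then so does every element, up to a power of `c`. -/
lemma exists_pow_smul_sub_mem_of_mem_adjoin {A : Type*} [CommRing A] [Algebra R A] {I : Ideal A}
    {c : R} {S : Set A} {D : Subalgebra R A} (h : ∀ s ∈ S, ∃ r ∈ D, c • s - r ∈ I) {G : A}
    (hG : G ∈ Algebra.adjoin R S) : ∃ N : ℕ, ∃ r ∈ D, c ^ N • G - r ∈ I := by
  induction hG using Algebra.adjoin_induction with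
  | mem s hs => simpa using ⟨1, by simpa using h s hs⟩
  | algebraMap r => exact ⟨0, _, D.algebraMap_mem r, by simp⟩
  | add G₁ G₂ _ _ ih₁ ih₂ =>
    obtain ⟨N₁, r₁, hr₁, h₁⟩ := ih₁
    obtain ⟨N₂, r₂, hr₂, h₂⟩ := ih₂
    refine ⟨N₁ + N₂, c ^ N₂ • r₁ + c ^ N₁ • r₂,
      D.add_mem (D.smul_mem hr₁ _) (D.smul_mem hr₂ _), ?_⟩
    convert I.add_mem (Submodule.smul_of_tower_mem I (c ^ N₂) h₁)
      (Submodule.smul_of_tower_mem I (c ^ N₁) h₂) using 1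
    simp only [Algebra.smul_def, map_pow]
    ring
  | mul G₁ G₂ _ _ ih₁ ih₂ =>
    obtain ⟨N₁, r₁, hr₁, h₁⟩ := ih₁
    obtain ⟨N₂, r₂, hr₂, h₂⟩ := ih₂
    refine ⟨N₁ + N₂, r₁ * r₂, D.mul_mem hr₁ hr₂, ?_⟩
    convert I.add_mem (I.mul_mem_left (c ^ N₂ • G₂) h₁) (I.mul_mem_left r₁ h₂) using 1
    simp only [Algebra.smul_def, map_pow]
    ring

lemma linearForm_eq (p : Fin 3 → R) :
    linearForm p = C (p 0) * X 0 + C (p 1) * X 1 + C (p 2) * X 2 := by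
  simp [linearForm, Fin.sum_univ_three]

lemma reesPresentation_X {n : ℕ} (f : Fin n → R) (i : Fin n) :
    reesPresentation f (X i) = Polynomial.C (f i) * Polynomial.X := by
  simp [reesPresentation]

lemma reesPresentation_C {n : ℕ} (f : Fin n → R) (r : R) :
    reesPresentation f (C r) = Polynomial.C r := by
  simp [reesPresentation]

lemma reesPresentation_signedMinors_relation (a b : R) (p : Fin 3 → R) :
    reesPresentation (signedMinors a b p) (C a * X 0 + C b * X 1) = 0 := by
  simp only [map_add, map_mul, reesPresentation_X, reesPresentation_C, signedMinors,
    Matrix.cons_val, map_neg]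
  ring

lemma reesPresentation_signedMinors_linearForm (a b : R) (p : Fin 3 → R) :
    reesPresentation (signedMinors a b p) (linearForm p) = 0 := by
  simp only [linearForm_eq, map_add, map_mul, reesPresentation_X, reesPresentation_C, signedMinors,
    Matrix.cons_val, map_neg, map_sub]
  ring

variable [IsDomain R]

lemma isRelPrime_C_C_mul_X [UniqueFactorizationMonoid R] {d e : R} (hd : d ≠ 0)
    (hde : ∀ π, Prime π → π ∣ d → ¬ π ∣ e) (i : Fin 3) :
    IsRelPrime (C d : MvPolynomial (Fin 3) R) (C e * X i) := by
  refine IsRelPrime.mul_right ?_ ?_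
  · intro u hud hue
    obtain ⟨r, hr, rfl⟩ := (MvPolynomial.dvd_C_iff_exists hd).mp hud
    rw [MvPolynomial.C_dvd_iff_dvd_coeff] at hue
    have hre : r ∣ e := by simpa using hue 0
    by_contra hu
    have hur : ¬ IsUnit r := fun h => hu (h.map C)
    obtain ⟨π, hπ, hdvd⟩ := WfDvdMonoid.exists_irreducible_factor hur (ne_zero_of_dvd_ne_zero hd hr)
    exact hde π hπ.prime (hdvd.trans hr) (hdvd.trans hre)
  · intro u hud hux
    obtain ⟨r, hr, rfl⟩ := (MvPolynomial.dvd_C_iff_exists hd).mp hud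
    rw [MvPolynomial.C_dvd_iff_dvd_coeff] at hux
    have := hux (Finsupp.single i 1)
    rw [MvPolynomial.coeff_X, if_pos rfl] at this
    exact (isUnit_of_dvd_one this).map C

/-- If `c` is relatively prime to `e` and `cᴺ W` is a multiple of `c t + a e`, then
`aᴺ W` is one, too. -/
lemma dvd_pow_mul_of_dvd_pow_mul {D : Type*} [CommRing D] [IsDomain D]
    [UniqueFactorizationMonoid D] {a c e t : D} (hc : c ≠ 0) (hce : IsRelPrime c e) (N : ℕ) (W : D)
    (h : c * t + a * e ∣ c ^ N * W) : c * t + a * e ∣ a ^ N * W := by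
  induction N generalizing W with
  | zero => simpa using h
  | succ N ih =>
    obtain ⟨Q, hQ⟩ := h
    have h1 : c ∣ e * (a * Q) :=
      ⟨c ^ N * W - t * Q, by linear_combination -hQ⟩
    obtain ⟨Q', hQ'⟩ := hce.dvd_of_dvd_mul_left h1
    have h2 : c ^ N * (a * W) = (c * t + a * e) * Q' := by
      apply mul_left_cancel₀ hc
      linear_combination a * hQ + (c * t + a * e) * hQ'
    have := ih (a * W) ⟨Q', h2⟩
    rwa [pow_succ, mul_assoc]

lemma exists_pow_mul_mem_span_of_reesPresentation_eq_zero [UniqueFactorizationMonoid R] {a b : R}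
    {p : Fin 3 → R} (hΔ : a * p 1 - b * p 0 ≠ 0)
    (hcop : ∀ π, Prime π → π ∣ a * p 1 - b * p 0 → ¬ π ∣ p 2)
    {F : MvPolynomial (Fin 3) R} (hF : reesPresentation (signedMinors a b p) F = 0) :
    ∃ N : ℕ, C a ^ N * F ∈ Ideal.span {C a * X 0 + C b * X 1, linearForm p} := by
  set c := a * p 1 - b * p 0 with hc
  set L : MvPolynomial (Fin 3) R := C c * X 1 + C a * (C (p 2) * X 2) with hL
  have hLmem : L ∈ Ideal.span {C a * X 0 + C b * X 1, linearForm p} := by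
    rw [Ideal.mem_span_pair]
    refine ⟨- C (p 0), C a, ?_⟩
    rw [linearForm_eq, hL, hc]
    simp only [map_sub, map_mul]
    ring
  have hψ : ∀ G ∈ Ideal.span {C a * X 0 + C b * X 1, linearForm p},
      reesPresentation (signedMinors a b p) G = 0 := by
    intro G hG
    obtain ⟨u, v, rfl⟩ := Ideal.mem_span_pair.mp hG
    rw [map_add, map_mul, map_mul, reesPresentation_signedMinors_relation,
      reesPresentation_signedMinors_linearForm, mul_zero, mul_zero, add_zero]
  obtain ⟨N, G, hG, hFG⟩ := exists_pow_smul_sub_mem_of_mem_adjoin (R := R) (c := a) (G := F)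
    (I := Ideal.span {C a * X 0 + C b * X 1}) (S := Set.range X)
    (D := Algebra.adjoin R {X 1, X 2}) (by
      rintro _ ⟨i, rfl⟩
      fin_cases i
      · refine ⟨- b • X 1, Subalgebra.smul_mem _ (Algebra.subset_adjoin (by simp)) _, ?_⟩
        convert Ideal.mem_span_singleton_self _ using 1
        simp [MvPolynomial.smul_eq_C_mul]
      · exact ⟨a • X 1, Subalgebra.smul_mem _ (Algebra.subset_adjoin (by simp)) _, by simp⟩
      · exact ⟨a • X 2, Subalgebra.smul_mem _ (Algebra.subset_adjoin (by simp)) _, by simp⟩)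
    (by rw [MvPolynomial.adjoin_range_X]; trivial)
  have hFG' : a ^ N • F - G ∈ Ideal.span {C a * X 0 + C b * X 1, linearForm p} :=
    Ideal.span_mono (by simp) hFG
  have hG0 : reesPresentation (signedMinors a b p) G = 0 := by
    have := hψ _ hFG'
    rw [map_sub, map_smul, hF, smul_zero, zero_sub, neg_eq_zero] at this
    exact this
  obtain ⟨M, r, hr, hGr⟩ := exists_pow_smul_sub_mem_of_mem_adjoin (R := R) (c := c) (G := G)
    (I := Ideal.span {L}) (D := Algebra.adjoin R {X 2}) (by
      rintro _ (rfl | rfl)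
      · refine ⟨- (a * p 2) • X 2, Subalgebra.smul_mem _ (Algebra.subset_adjoin (by simp)) _, ?_⟩
        convert Ideal.mem_span_singleton_self _ using 1
        simp [MvPolynomial.smul_eq_C_mul, hL, mul_assoc]
      · exact ⟨c • X 2, Subalgebra.smul_mem _ (Algebra.subset_adjoin (by simp)) _, by simp⟩) hG
  have hr0 : r = 0 := by
    have h0 : reesPresentation (signedMinors a b p) r = 0 := by
      have := hψ _ (Ideal.span_le.mpr (Set.singleton_subset_iff.mpr hLmem) hGr)
      rw [map_sub, map_smul, hG0, smul_zero, zero_sub, neg_eq_zero] at this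
      exact this
    rw [Algebra.adjoin_singleton_eq_range_aeval] at hr
    obtain ⟨P, rfl⟩ := hr
    have hP : P.comp (Polynomial.C c * Polynomial.X) = 0 := by
      rw [← h0]
      change _ = reesPresentation (signedMinors a b p) (Polynomial.aeval (X 2) P)
      rw [← Polynomial.aeval_algHom_apply, reesPresentation_X]
      rfl
    have : P = 0 := by
      ext i
      have := congrArg (fun Q => Polynomial.coeff Q i) hP
      simp only [Polynomial.comp_C_mul_X_coeff, Polynomial.coeff_zero] at this
      exact (mul_eq_zero.mp this).resolve_right (pow_ne_zero _ hΔ)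
    rw [this]
    exact map_zero _
  rw [hr0, sub_zero, Ideal.mem_span_singleton, MvPolynomial.smul_eq_C_mul, map_pow] at hGr
  have hLG := dvd_pow_mul_of_dvd_pow_mul (by simpa using hΔ)
    (isRelPrime_C_C_mul_X hΔ hcop 2) M G hGr
  refine ⟨M + N, ?_⟩
  have h1 : C a ^ M * (a ^ N • F - G) + C a ^ M * G ∈
      Ideal.span {C a * X 0 + C b * X 1, linearForm p} :=
    Ideal.add_mem _ (Ideal.mul_mem_left _ _ hFG') (Ideal.mem_of_dvd _ hLG hLmem)
  convert h1 using 1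
  rw [MvPolynomial.smul_eq_C_mul, map_pow]
  ring

end Elimination

section ColumnIdeal

/-- If the entries of the cross product of `σ a` and `σ b` have no common prime factor, where `σ`
is an endomorphism that is a section of reduction modulo `ξ`, then `ξ` is a nonzerodivisor
modulo the entries of the cross product of `a` and `b`. -/
lemma mem_span_cross_of_mul_mem {D : Type*} [CommRing D] [IsDomain D]
    [UniqueFactorizationMonoid D] (σ : D →+* D) {ξ : D} (hξ : ξ ≠ 0) (hσξ : σ ξ = 0)
    (hσ : ∀ F, ξ ∣ F - σ F) {a b : Fin 3 → D} (hab : crossProduct (σ ∘ a) (σ ∘ b) ≠ 0)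
    (hprime : ∀ π : D, Prime π → ∃ i, ¬ π ∣ crossProduct (σ ∘ a) (σ ∘ b) i) {F : D}
    (hF : ξ * F ∈ Ideal.span (Set.range (crossProduct a b))) :
    F ∈ Ideal.span (Set.range (crossProduct a b)) := by
  have hmem (v : Fin 3 → D) : v ⬝ᵥ crossProduct a b ∈ Ideal.span (Set.range (crossProduct a b)) :=
    Ideal.sum_mem _ fun i _ => Ideal.mul_mem_left _ _ (Ideal.subset_span ⟨i, rfl⟩)
  obtain ⟨v, hv⟩ := Ideal.mem_span_range_iff_exists_fun.mp hF
  change v ⬝ᵥ crossProduct a b = ξ * F at hv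
  have hcross : σ ∘ crossProduct a b = crossProduct (σ ∘ a) (σ ∘ b) := by
    ext i
    fin_cases i <;> simp [cross_apply]
  have hσv : (σ ∘ v) ⬝ᵥ crossProduct (σ ∘ a) (σ ∘ b) = 0 := by
    rw [← hcross, ← RingHom.map_dotProduct, hv, map_mul, hσξ, zero_mul]
  obtain ⟨c₁, c₂, hc⟩ := exists_combination_of_syzygy hab hprime hσv
  have hdiv : ∀ i, ξ ∣ v i - (c₁ * a i + c₂ * b i) := by
    intro i
    have h := congrFun hc i
    simp only [Function.comp_apply, Pi.add_apply, Pi.smul_apply, smul_eq_mul] at h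
    have : v i - (c₁ * a i + c₂ * b i) =
        (v i - σ (v i)) - c₁ * (a i - σ (a i)) - c₂ * (b i - σ (b i)) := by
      linear_combination h
    rw [this]
    exact ((hσ _).sub ((hσ _).mul_left _)).sub ((hσ _).mul_left _)
  choose w hw using hdiv
  have hv' : v = c₁ • a + c₂ • b + ξ • w := by
    ext i
    simp only [Pi.add_apply, Pi.smul_apply, smul_eq_mul]
    linear_combination hw i
  have : ξ * F = ξ * (w ⬝ᵥ crossProduct a b) := by
    rw [← hv, hv']
    simp [add_dotProduct]
  rw [mul_left_cancel₀ hξ this]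
  exact hmem w

variable {R : Type*} [CommRing R]

/-- The signed maximal minors of the Sylvester matrix: the two relations of the symmetric algebra
and the Sylvester form. -/
noncomputable def sylvesterMinors (a b yd : R) (p q q' : Fin 3 → R) :
    Fin 3 → MvPolynomial (Fin 3) R :=
  ![linearForm p, -(C a * X 0 + C b * X 1), X 0 * linearForm q' - X 1 * C yd * linearForm q]

/-- The entries of the cross product of the two columns of the Sylvester matrix. -/
lemma cross_columns {a b yn yd : R} {p q q' : Fin 3 → R} (hp : ∀ i, p i = q i * a + q' i * yn)
    (hb : b = yd * yn) :
    crossProduct ![(X 0 : MvPolynomial (Fin 3) R), linearForm q, C (-yn)]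
      ![X 1 * C yd, linearForm q', C a] =
    sylvesterMinors a b yd p q q' := by
  have hlin : linearForm p = linearForm q * C a + linearForm q' * C yn := by
    simp only [linearForm_eq, hp, map_add, map_mul]
    ring
  rw [cross_apply, sylvesterMinors, hlin, hb]
  simp only [Matrix.cons_val, map_neg, map_mul]
  congr 1
  · ring
  congr 1
  · ring
  congr 1
  ring

lemma map_linearForm {S : Type*} [CommRing S] (σ : R →+* S) (p : Fin 3 → R) :
    MvPolynomial.map σ (linearForm p) = linearForm (σ ∘ p) := by
  simp [linearForm]

/-- The ideal of minors of the Sylvester matrix is the presentation ideal of the Rees algebra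
as soon as `x` is a nonzerodivisor modulo it. -/
lemma ker_reesPresentation_eq_span [IsDomain R] [UniqueFactorizationMonoid R] {x b yn yd : R}
    {m : ℕ} {p q q' : Fin 3 → R} (hx : x ≠ 0)
    (hp : ∀ i, p i = q i * x ^ m + q' i * yn) (hb : b = yd * yn)
    (hΔ : x ^ m * p 1 - b * p 0 ≠ 0)
    (hcop : ∀ π, Prime π → π ∣ x ^ m * p 1 - b * p 0 → ¬ π ∣ p 2)
    (hreg : ∀ F : MvPolynomial (Fin 3) R,
      C x * F ∈ Ideal.span (Set.range (sylvesterMinors (x ^ m) b yd p q q')) →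
      F ∈ Ideal.span (Set.range (sylvesterMinors (x ^ m) b yd p q q'))) :
    RingHom.ker (reesPresentation (signedMinors (x ^ m) b p)) =
      Ideal.span (Set.range (sylvesterMinors (x ^ m) b yd p q q')) := by
  refine le_antisymm ?_ (Ideal.span_le.mpr ?_)
  · intro F hF
    obtain ⟨N, hN⟩ := exists_pow_mul_mem_span_of_reesPresentation_eq_zero hΔ hcop hF
    have hmem : C (x ^ m) ^ N * F ∈ Ideal.span (Set.range
        (sylvesterMinors (x ^ m) b yd p q q')) := by
      refine Ideal.span_le.mpr ?_ hN
      rintro _ (rfl | rfl)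
      · rw [SetLike.mem_coe, ← neg_mem_iff]
        exact Ideal.subset_span ⟨1, rfl⟩
      · exact Ideal.subset_span ⟨0, rfl⟩
    rw [map_pow C x m, ← pow_mul] at hmem
    generalize m * N = M at hmem
    induction M with
    | zero => simpa using hmem
    | succ M ih =>
      rw [pow_succ', mul_assoc] at hmem
      exact ih (hreg _ hmem)
  · rintro _ ⟨i, rfl⟩
    rw [SetLike.mem_coe, RingHom.mem_ker]
    fin_cases i
    · exact reesPresentation_signedMinors_linearForm _ _ _
    · change reesPresentation _ (-(C (x ^ m) * X 0 + C b * X 1)) = 0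
      rw [map_neg, reesPresentation_signedMinors_relation, neg_zero]
    · change reesPresentation _ (X 0 * linearForm q' - X 1 * C yd * linearForm q) = 0
      have hlin : linearForm p = linearForm q * C (x ^ m) + linearForm q' * C yn := by
        simp only [linearForm_eq, hp, map_add, map_mul]
        ring
      have h : C (x ^ m) * (X 0 * linearForm q' - X 1 * C yd * linearForm q) =
          linearForm q' * (C (x ^ m) * X 0 + C b * X 1) - X 1 * C yd * linearForm p := by
        rw [hlin, hb, map_mul]
        ring
      have h' := congrArg (reesPresentation (signedMinors (x ^ m) b p)) h
      rw [map_mul, reesPresentation_C, map_sub (reesPresentation _) (_ * (_ + _)),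
        map_mul _ _ (_ + _), reesPresentation_signedMinors_relation, map_mul _ _ (linearForm p),
        reesPresentation_signedMinors_linearForm, mul_zero, mul_zero, sub_zero] at h'
      exact (mul_eq_zero.mp h').resolve_left (by simpa using pow_ne_zero m hx)

end ColumnIdeal

section HeightTwo

variable {R : Type*} [CommRing R]

/-- The presentation of the Rees algebra by a polynomial ring in two variables, restricted to the
first relation. -/
lemma reesPresentation_signedMinors_eq_comp (a b : R) (p : Fin 3 → R) :
    reesPresentation (signedMinors a b p) =
      (aeval ![Polynomial.C (p 2) * Polynomial.X,
        Polynomial.C (a * p 1 - b * p 0) * Polynomial.X]).comp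
      (aeval ![C b * X 0, -(C a * X 0), X 1] :
        MvPolynomial (Fin 3) R →ₐ[R] MvPolynomial (Fin 2) R) := by
  refine MvPolynomial.algHom_ext fun i => ?_
  rw [reesPresentation_X]
  fin_cases i <;> simp [signedMinors, mul_assoc]

variable [IsDomain R] {a b : R} {p : Fin 3 → R}

/-- The kernel of the presentation of the Rees algebra strictly contains a nonzero prime. -/
lemma exists_prime_lt_ker_reesPresentation (ha : a ≠ 0) (hp : p 2 ≠ 0) :
    ∃ P : Ideal (MvPolynomial (Fin 3) R), P.IsPrime ∧ ⊥ < P ∧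
      P < RingHom.ker (reesPresentation (signedMinors a b p)) := by
  let ρ : MvPolynomial (Fin 3) R →ₐ[R] MvPolynomial (Fin 2) R :=
    aeval ![C b * X 0, -(C a * X 0), X 1]
  refine ⟨RingHom.ker ρ, RingHom.ker_isPrime _, ?_, lt_of_le_of_ne ?_ ?_⟩
  · refine bot_lt_iff_ne_bot.mpr (Submodule.ne_bot_iff _ |>.mpr ⟨C a * X 0 + C b * X 1, ?_, ?_⟩)
    · rw [RingHom.mem_ker]
      simp only [ρ, map_add, map_mul, aeval_X, algHom_C, Matrix.cons_val, algebraMap_eq]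
      ring
    · intro h
      have := congrArg (eval ![1, 0, 0]) h
      simp [ha] at this
  · intro F hF
    rw [RingHom.mem_ker] at hF ⊢
    rw [reesPresentation_signedMinors_eq_comp]
    change aeval _ (ρ F) = 0
    rw [hF, map_zero]
  · intro h
    have hmem : linearForm p ∈ RingHom.ker ρ := by
      rw [h, RingHom.mem_ker, reesPresentation_signedMinors_linearForm]
    rw [RingHom.mem_ker] at hmem
    have := congrArg (eval ![0, 1]) hmem
    simp [ρ, linearForm_eq, hp] at this

lemma two_le_height_ker_reesPresentation (ha : a ≠ 0) (hp : p 2 ≠ 0) :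
    2 ≤ (RingHom.ker (reesPresentation (signedMinors a b p))).height := by
  obtain ⟨P, hP, hbot, hlt⟩ := exists_prime_lt_ker_reesPresentation (b := b) ha hp
  have hK : (RingHom.ker (reesPresentation (signedMinors a b p))).IsPrime :=
    RingHom.ker_isPrime _
  calc (2 : ℕ∞) = 0 + 1 + 1 := by norm_num
    _ ≤ (⊥ : Ideal (MvPolynomial (Fin 3) R)).height + 1 + 1 := by gcongr; exact bot_le
    _ ≤ P.height + 1 := by gcongr; exact Ideal.height_add_one_le_of_lt_of_isPrime hbot
    _ ≤ _ := Ideal.height_add_one_le_of_lt_of_isPrime hlt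

lemma ringKrullDim_quotient_add_two_le (ha : a ≠ 0) (hp : p 2 ≠ 0) :
    ringKrullDim (MvPolynomial (Fin 3) R ⧸ RingHom.ker (reesPresentation (signedMinors a b p))) + 2
      ≤ ringKrullDim (MvPolynomial (Fin 3) R) := by
  obtain ⟨P, hP, hbot, hlt⟩ := exists_prime_lt_ker_reesPresentation (b := b) ha hp
  set K := RingHom.ker (reesPresentation (signedMinors a b p))
  obtain ⟨F, hF, hF0⟩ := Submodule.exists_mem_ne_zero_of_ne_bot hbot.ne'
  obtain ⟨G, hG, hGP⟩ := SetLike.exists_of_lt hlt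
  have h₁ : ringKrullDim (MvPolynomial (Fin 3) R ⧸ P) + 1 ≤ ringKrullDim (MvPolynomial (Fin 3) R) :=
    ringKrullDim_succ_le_of_surjective (Ideal.Quotient.mk P) Ideal.Quotient.mk_surjective
      (mem_nonZeroDivisors_of_ne_zero hF0) (Ideal.Quotient.eq_zero_iff_mem.mpr hF)
  have h₂ : ringKrullDim (MvPolynomial (Fin 3) R ⧸ K) + 1 ≤
      ringKrullDim (MvPolynomial (Fin 3) R ⧸ P) :=
    ringKrullDim_succ_le_of_surjective (Ideal.Quotient.factor hlt.le)
      (Ideal.Quotient.factor_surjective hlt.le)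
      (r := Ideal.Quotient.mk P G)
      (mem_nonZeroDivisors_of_ne_zero (mt Ideal.Quotient.eq_zero_iff_mem.mp hGP))
      (by rw [Ideal.Quotient.factor_mk]; exact Ideal.Quotient.eq_zero_iff_mem.mpr hG)
  calc _ = ringKrullDim (MvPolynomial (Fin 3) R ⧸ K) + 1 + 1 := by rw [add_assoc]; norm_num
    _ ≤ ringKrullDim (MvPolynomial (Fin 3) R ⧸ P) + 1 := by gcongr
    _ ≤ _ := h₁

lemma height_ker_reesPresentation [IsNoetherianRing R] [UniqueFactorizationMonoid R]
    (ha : a ≠ 0) (hp : p 2 ≠ 0) (hΔ : a * p 1 - b * p 0 ≠ 0)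
    (hcop : ∀ π, Prime π → π ∣ a * p 1 - b * p 0 → ¬ π ∣ p 2) :
    (RingHom.ker (reesPresentation (signedMinors a b p))).height = 2 := by
  refine le_antisymm ?_ (two_le_height_ker_reesPresentation ha hp)
  have hK : (RingHom.ker (reesPresentation (signedMinors a b p))).IsPrime :=
    RingHom.ker_isPrime _
  refine (Ideal.height_le_card_of_mem_minimalPrimes_span
    (s := {C a * X 0 + C b * X 1, linearForm p}) (by simp) ⟨⟨hK, ?_⟩, ?_⟩).trans ?_
  · refine Ideal.span_le.mpr ?_
    rintro _ (rfl | rfl)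
    · exact reesPresentation_signedMinors_relation _ _ _
    · exact reesPresentation_signedMinors_linearForm _ _ _
  · rintro Q ⟨hQ, hle⟩ hQK F hF
    obtain ⟨N, hN⟩ := exists_pow_mul_mem_span_of_reesPresentation_eq_zero hΔ hcop hF
    refine (hQ.mem_or_mem (hle hN)).resolve_left fun h => ha ?_
    have := hQK (hQ.mem_of_pow_mem _ h)
    rw [RingHom.mem_ker, reesPresentation_C] at this
    simpa using this
  · exact_mod_cast Set.ncard_insert_le _ _ |>.trans (by simp)

end HeightTwo

section Divisibility

lemma not_le_span_singleton_of_two_le_idealHeight {A : Type*} [CommRing A] [IsNoetherianRing A]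
    {I : Ideal A} (hI : 2 ≤ idealHeight I) {π : A} (hπ : Prime π) : ¬ I ≤ Ideal.span {π} := by
  intro h
  have : (Ideal.span {π}).IsPrime := (Ideal.span_singleton_prime hπ.ne_zero).mpr hπ
  have h2 := (hI.trans (idealHeight_le_height h)).trans
    (Ideal.height_span_singleton_le_one hπ.not_isUnit)
  norm_num at h2

/-- The elements of a factorial domain without a common prime factor with `b` are nonzero if
`b` is not a unit. -/
lemma ne_zero_of_no_common_prime {A : Type*} [CommRing A] [IsDomain A]
    [UniqueFactorizationMonoid A] {a b ϖ : A} (hϖ : Prime ϖ)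
    (h : ∀ π, Prime π → π ∣ a → ¬ π ∣ b) (hb : ¬ IsUnit b) : a ≠ 0 := by
  rintro rfl
  by_cases hb0 : b = 0
  · exact h ϖ hϖ (dvd_zero _) (hb0 ▸ dvd_zero _)
  · obtain ⟨π, hπ, hdvd⟩ := WfDvdMonoid.exists_irreducible_factor hb hb0
    exact h π hπ.prime (dvd_zero _) hdvd

variable {A : Type*} [CommRing A]

lemma eval_mem_of_mem_map_C {𝔪 : Ideal A} {F : MvPolynomial (Fin 3) A}
    (hF : F ∈ 𝔪.map (C : A →+* MvPolynomial (Fin 3) A)) (v : Fin 3 → A) : eval v F ∈ 𝔪 := by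
  have : 𝔪.map (C : A →+* MvPolynomial (Fin 3) A) ≤ 𝔪.comap (eval v) := by
    refine Ideal.map_le_iff_le_comap.mpr fun r hr => ?_
    simpa using hr
  exact this hF

end Divisibility

section AxisOrder

variable {k : Type*} [Field k]

/-- Every monomial of `f` has degree at least `N` in the first two variables. -/
def HasAxisOrder (N : ℕ) (f : MvPolynomial (Fin 3) k) : Prop :=
  ∀ d ∈ f.support, N ≤ d 0 + d 1

lemma HasAxisOrder.add {N : ℕ} {f g : MvPolynomial (Fin 3) k} (hf : HasAxisOrder N f)
    (hg : HasAxisOrder N g) : HasAxisOrder N (f + g) := by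
  classical
  intro d hd
  rcases Finset.mem_union.mp (support_add hd) with h | h
  exacts [hf d h, hg d h]

lemma HasAxisOrder.mul {M N : ℕ} {f g : MvPolynomial (Fin 3) k} (hf : HasAxisOrder M f)
    (hg : HasAxisOrder N g) : HasAxisOrder (M + N) (f * g) := by
  classical
  intro d hd
  obtain ⟨d₁, h₁, d₂, h₂, rfl⟩ := Finset.mem_add.mp (support_mul f g hd)
  have := hf d₁ h₁
  have := hg d₂ h₂
  simp only [Finsupp.add_apply]
  omega

lemma hasAxisOrder_X_pow {i : Fin 3} (hi : i = 0 ∨ i = 1) (N : ℕ) :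
    HasAxisOrder N (X i ^ N : MvPolynomial (Fin 3) k) := by
  intro d hd
  rw [X_pow_eq_monomial] at hd
  obtain rfl := Finset.mem_singleton.mp (support_monomial_subset hd)
  rcases hi with rfl | rfl <;> simp

lemma hasAxisOrder_one_of_mem {f : MvPolynomial (Fin 3) k}
    (hf : f ∈ Ideal.span ({X 0, X 1} : Set (MvPolynomial (Fin 3) k))) : HasAxisOrder 1 f := by
  have h : ({X 0, X 1} : Set (MvPolynomial (Fin 3) k)) = X '' {0, 1} := by
    simp [Set.image_insert_eq]
  rw [h, mem_ideal_span_X_image] at hf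
  intro d hd
  obtain ⟨i, hi, hdi⟩ := hf d hd
  rcases hi with rfl | rfl <;> omega

lemma HasAxisOrder.degreeOf_lt {N ε : ℕ} {f : MvPolynomial (Fin 3) k} (hf : HasAxisOrder (N + 1) f)
    (hdeg : f.IsHomogeneous (N + ε)) (hε : 0 < ε) : degreeOf 2 f < ε := by
  rw [degreeOf_lt_iff hε]
  intro d hd
  have h := hdeg (mem_support_iff.mp hd)
  rw [Finsupp.weight_apply, Finsupp.sum_fintype _ _ (by simp)] at h
  simp only [Fin.sum_univ_three, Pi.one_apply, smul_eq_mul, mul_one] at h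
  have := hf d hd
  omega

end AxisOrder

section AxisComponent

variable {k : Type*} [Field k]

variable (k) in
/-- The ideal of the line `x = y = 0`. -/
noncomputable def axisIdeal : Ideal (MvPolynomial (Fin 3) k) :=
  Ideal.span {X 0, X 1}

lemma X_zero_mem_axis : (X 0 : MvPolynomial (Fin 3) k) ∈ axisIdeal k :=
  Ideal.subset_span (by simp)

lemma X_one_mem_axis : (X 1 : MvPolynomial (Fin 3) k) ∈ axisIdeal k :=
  Ideal.subset_span (by simp)

lemma one_notMem_axis : (1 : MvPolynomial (Fin 3) k) ∉ axisIdeal k := by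
  intro h
  have := hasAxisOrder_one_of_mem h 0 (by simp)
  simp at this

/-- If the `(x,y)`-primary component of an ideal is `(x^m, y^n)`, then the ideal is not contained
in `(x^m) + (x,y) y^n`. -/
lemma not_le_of_axis_component {I : Ideal (MvPolynomial (Fin 3) k)} {m n : ℕ} (hm : m ≠ 0)
    (h : ∃ u, u ∉ axisIdeal k ∧ u * X 1 ^ n ∈ I) :
    ¬ I ≤ Ideal.span {X 0 ^ m} ⊔ axisIdeal k * Ideal.span {X 1 ^ n} := by
  intro hle
  obtain ⟨u, hu, hmem⟩ := h
  obtain ⟨_, hA, _, hB, hAB⟩ := Submodule.mem_sup.mp (hle hmem)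
  obtain ⟨A, rfl⟩ := Ideal.mem_span_singleton'.mp hA
  obtain ⟨B, hBmem, rfl⟩ := Ideal.mem_mul_span_singleton.mp hB
  have hdvd : (X 0 : MvPolynomial (Fin 3) k) ∣ (u - B) * X 1 ^ n := by
    refine (dvd_pow_self (X 0) hm).trans ⟨A, ?_⟩
    linear_combination -hAB
  rcases X_prime.dvd_or_dvd hdvd with h0 | h0
  · refine hu ?_
    have := Ideal.add_mem _ (Ideal.mem_of_dvd _ h0 X_zero_mem_axis) hBmem
    rwa [sub_add_cancel] at this
  · have := X_dvd_X.mp (X_prime.dvd_of_dvd_pow h0)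
    simp at this

variable {m n ε : ℕ} {p q q' : Fin 3 → MvPolynomial (Fin 3) k}

/-- The Sylvester form does not vanish along the line `x = y = 0`. -/
lemma sylvesterForm_notMem_map_C (hn : 1 ≤ n) (hnm : n ≤ m) (hε : 1 ≤ ε)
    (hpdeg : ∀ i, (p i).IsHomogeneous (n + ε)) (hp : ∀ i, p i = q i * X 0 ^ m + q' i * X 1 ^ n)
    {I : Ideal (MvPolynomial (Fin 3) k)} (hIle : I ≤ Ideal.span ({X 0 ^ m, X 1 ^ m} ∪ Set.range p))
    (hI : ∃ u, u ∉ axisIdeal k ∧ u * X 1 ^ n ∈ I)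
    (hz : m = n → degreeOf 2 (X 0 ^ m * p 1 - X 1 ^ m * p 0) = ε ∨ degreeOf 2 (p 2) = ε) :
    X 0 * linearForm q' - X 1 * C (X 1 ^ (m - n)) * linearForm q ∉
      (axisIdeal k).map (C : _ →+* MvPolynomial (Fin 3) (MvPolynomial (Fin 3) k)) := by
  intro hmem
  have hev (v : Fin 3 → MvPolynomial (Fin 3) k) : v 0 * (q' 0 * v 0 + q' 1 * v 1 + q' 2 * v 2) -
      v 1 * X 1 ^ (m - n) * (q 0 * v 0 + q 1 * v 1 + q 2 * v 2) ∈ axisIdeal k := by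
    have := eval_mem_of_mem_map_C hmem v
    simpa only [linearForm_eq, map_sub, map_mul, map_add, eval_C, eval_X] using this
  have e100 : q' 0 ∈ axisIdeal k := by simpa using hev ![1, 0, 0]
  have e2' : q' 2 ∈ axisIdeal k := by
    have : q' 0 + q' 2 ∈ axisIdeal k := by simpa using hev ![1, 0, 1]
    exact (Ideal.add_mem_iff_right _ e100).mp this
  have e110 := hev ![1, 1, 0]
  simp only [Matrix.cons_val, mul_one, mul_zero, add_zero, one_mul] at e110
  rcases hnm.lt_or_eq with hlt | rfl
  · have hyd : (X 1 ^ (m - n) : MvPolynomial (Fin 3) k) ∈ axisIdeal k :=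
      Ideal.pow_mem_of_mem _ X_one_mem_axis _ (by omega)
    have e1' : q' 1 ∈ axisIdeal k := by
      have := Ideal.add_mem _ e110 (Ideal.mul_mem_right (q 0 + q 1) _ hyd)
      rw [sub_add_cancel] at this
      exact (Ideal.add_mem_iff_right _ e100).mp this
    refine not_le_of_axis_component (m := m) (by omega) hI (hIle.trans (Ideal.span_le.mpr ?_))
    have hx : (X 0 ^ m : MvPolynomial (Fin 3) k) ∈
        Ideal.span {X 0 ^ m} ⊔ axisIdeal k * Ideal.span {X 1 ^ n} :=
      Ideal.mem_sup_left (Ideal.mem_span_singleton_self _)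
    have hy {r : MvPolynomial (Fin 3) k} (hr : r ∈ axisIdeal k) :
        r * X 1 ^ n ∈ Ideal.span {X 0 ^ m} ⊔ axisIdeal k * Ideal.span {X 1 ^ n} :=
      Ideal.mem_sup_right (Ideal.mul_mem_mul hr (Ideal.mem_span_singleton_self _))
    rintro _ ((rfl | rfl) | ⟨i, rfl⟩)
    · exact hx
    · have := hy hyd
      rwa [← pow_add, Nat.sub_add_cancel hnm] at this
    · rw [SetLike.mem_coe, hp]
      refine Ideal.add_mem _ (Ideal.mul_mem_left _ _ hx) (hy ?_)
      fin_cases i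
      exacts [e100, e1', e2']
  · have e1 : q 1 ∈ axisIdeal k := by
      have := hev ![0, 1, 0]
      simpa using this
    have e2 : q 2 ∈ axisIdeal k := by
      have : -(q 1 + q 2) ∈ axisIdeal k := by simpa using hev ![0, 1, 1]
      exact (Ideal.add_mem_iff_right _ e1).mp (neg_mem_iff.mp this)
    have e01 : q' 1 - q 0 ∈ axisIdeal k := by
      have := Ideal.add_mem _ (Ideal.sub_mem _ e110 e100) e1
      convert this using 1
      simp only [Nat.sub_self, pow_zero]
      ring
    have hX := hasAxisOrder_X_pow (k := k) (i := 0) (.inl rfl) n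
    have hY := hasAxisOrder_X_pow (k := k) (i := 1) (.inr rfl) n
    have hp2 : HasAxisOrder (n + 1) (p 2) := by
      rw [hp, add_comm n]
      exact ((hasAxisOrder_one_of_mem e2).mul hX).add ((hasAxisOrder_one_of_mem e2').mul hY)
    have hD : HasAxisOrder (n + n + 1) (X 0 ^ n * p 1 - X 1 ^ n * p 0) := by
      have : (X 0 ^ n * p 1 - X 1 ^ n * p 0 : MvPolynomial (Fin 3) k) = q 1 * (X 0 ^ n * X 0 ^ n) +
          (q' 1 - q 0) * (X 0 ^ n * X 1 ^ n) + (-q' 0) * (X 1 ^ n * X 1 ^ n) := by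
        rw [hp, hp]
        ring
      rw [this, add_comm _ 1]
      exact (((hasAxisOrder_one_of_mem e1).mul (hX.mul hX)).add
        ((hasAxisOrder_one_of_mem e01).mul (hX.mul hY))).add
        ((hasAxisOrder_one_of_mem (neg_mem e100)).mul (hY.mul hY))
    have hDdeg : (X 0 ^ n * p 1 - X 1 ^ n * p 0 : MvPolynomial (Fin 3) k).IsHomogeneous
        (n + n + ε) := by
      rw [add_assoc]
      exact ((isHomogeneous_X_pow 0 n).mul (hpdeg 1)).sub ((isHomogeneous_X_pow 1 n).mul (hpdeg 0))
    rcases hz rfl with h | h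
    · exact (hD.degreeOf_lt hDdeg hε).ne h
    · exact (hp2.degreeOf_lt (hpdeg 2) hε).ne h

end AxisComponent

section Reduction

variable {k : Type*} [Field k]

/-- Reduction modulo `x`, viewed as an endomorphism of `k[x,y,z]`. -/
noncomputable def setXZero : MvPolynomial (Fin 3) k →+* MvPolynomial (Fin 3) k :=
  (aeval ![0, X 1, X 2] : MvPolynomial (Fin 3) k →ₐ[k] MvPolynomial (Fin 3) k)

lemma setXZero_X (i : Fin 3) :
    setXZero (X i : MvPolynomial (Fin 3) k) = (![0, X 1, X 2] : Fin 3 → _) i := by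
  simp [setXZero]

lemma X_dvd_sub_setXZero (r : MvPolynomial (Fin 3) k) : X 0 ∣ r - setXZero r := by
  induction r using MvPolynomial.induction_on with
  | C c => simp [setXZero]
  | add r s hr hs =>
    rw [map_add, add_sub_add_comm]
    exact hr.add hs
  | mul_X r i hr =>
    have hi : X 0 ∣ (X i : MvPolynomial (Fin 3) k) - setXZero (X i) := by
      rw [setXZero_X]
      fin_cases i <;> simp
    have : r * X i - setXZero (r * X i) =
        (r - setXZero r) * X i + setXZero r * (X i - setXZero (X i)) := by
      rw [map_mul]
      ring
    rw [this]
    exact (hr.mul_right _).add (hi.mul_left _)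

lemma C_X_dvd_sub_map_setXZero (F : MvPolynomial (Fin 3) (MvPolynomial (Fin 3) k)) :
    C (X 0) ∣ F - MvPolynomial.map setXZero F := by
  rw [C_dvd_iff_dvd_coeff]
  intro d
  rw [coeff_sub, coeff_map]
  exact X_dvd_sub_setXZero _

lemma X_dvd_of_setXZero_eq_zero {r : MvPolynomial (Fin 3) k} (h : setXZero r = 0) : X 0 ∣ r := by
  simpa [h] using X_dvd_sub_setXZero r

variable {m n : ℕ} {p q q' : Fin 3 → MvPolynomial (Fin 3) k}

lemma exists_not_dvd_sylvesterMinors_setXZero (hn : 1 ≤ n) (hnm : n ≤ m)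
    (hcop : ∀ π, Prime π → π ∣ X 0 ^ m * p 1 - X 1 ^ m * p 0 → ¬ π ∣ p 2)
    (hsyl : X 0 * linearForm q' - X 1 * C (X 1 ^ (m - n)) * linearForm q ∉
      (axisIdeal k).map
        (C : _ →+* MvPolynomial (Fin 3) (MvPolynomial (Fin 3) k)))
    (π : MvPolynomial (Fin 3) (MvPolynomial (Fin 3) k)) (hπ : Prime π) :
    ∃ i, ¬ π ∣ sylvesterMinors 0 (X 1 ^ m) (X 1 ^ (m - n)) (setXZero ∘ p) (setXZero ∘ q)
      (setXZero ∘ q') i := by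
  by_contra! hdvd
  have h0 : π ∣ linearForm (setXZero ∘ p) := hdvd 0
  have h1 : π ∣ C (X 1 ^ m) * X 1 := by
    have : π ∣ -(C 0 * X 0 + C (X 1 ^ m) * X 1) := hdvd 1
    rw [map_zero, zero_mul, zero_add] at this
    exact dvd_neg.mp this
  have h2 : π ∣ X 0 * linearForm (setXZero ∘ q') -
    X 1 * C (X 1 ^ (m - n)) * linearForm (setXZero ∘ q) := hdvd 2
  rcases hπ.dvd_or_dvd h1 with h | h
  · rw [map_pow] at h
    have hy : Prime (C (X 1) : MvPolynomial (Fin 3) (MvPolynomial (Fin 3) k)) :=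
      (MvPolynomial.prime_C_iff (σ := Fin 3)).mpr X_prime
    have hyπ := (hπ.associated_of_dvd hy (hπ.dvd_of_dvd_pow h)).symm.dvd.trans h2
    apply hsyl
    set F := X 0 * linearForm q' - X 1 * C (X 1 ^ (m - n)) * linearForm q with hF
    have hσF : MvPolynomial.map setXZero F = X 0 * linearForm (setXZero ∘ q') -
        X 1 * C (X 1 ^ (m - n)) * linearForm (setXZero ∘ q) := by
      simp [hF, map_linearForm, setXZero_X]
    rw [← hσF] at hyπ
    rw [← sub_add_cancel F (MvPolynomial.map setXZero F)]
    exact Ideal.add_mem _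
      (Ideal.mem_of_dvd _ (C_X_dvd_sub_map_setXZero F)
        (Ideal.mem_map_of_mem _ X_zero_mem_axis))
      (Ideal.mem_of_dvd _ hyπ (Ideal.mem_map_of_mem _ X_one_mem_axis))
  · have hX := (hπ.associated_of_dvd X_prime h).symm.dvd.trans h0
    obtain ⟨G, hG⟩ := hX
    have hp0 : X 0 ∣ p 0 := X_dvd_of_setXZero_eq_zero (by
      have := congrArg (eval ![1, 0, 0]) hG
      simpa [linearForm_eq] using this)
    have hp2 : X 0 ∣ p 2 := X_dvd_of_setXZero_eq_zero (by
      have := congrArg (eval ![0, 0, 1]) hG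
      simpa [linearForm_eq] using this)
    exact hcop _ X_prime (((dvd_pow_self _ (by omega)).mul_right _).sub (hp0.mul_left _)) hp2

lemma comp_vecCons_three {α β : Type*} (f : α → β) (u v w : α) :
    f ∘ ![u, v, w] = ![f u, f v, f w] := by
  ext i
  fin_cases i <;> rfl

/-- `x` is a nonzerodivisor modulo the ideal of minors of the Sylvester matrix. -/
lemma C_X_mul_mem_span_sylvesterMinors (hn : 1 ≤ n) (hnm : n ≤ m)
    (hp : ∀ i, p i = q i * X 0 ^ m + q' i * X 1 ^ n)
    (hcop : ∀ π, Prime π → π ∣ X 0 ^ m * p 1 - X 1 ^ m * p 0 → ¬ π ∣ p 2)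
    (hsyl : X 0 * linearForm q' - X 1 * C (X 1 ^ (m - n)) * linearForm q ∉
      (axisIdeal k).map
        (C : _ →+* MvPolynomial (Fin 3) (MvPolynomial (Fin 3) k)))
    {F : MvPolynomial (Fin 3) (MvPolynomial (Fin 3) k)}
    (hF : C (X 0) * F ∈ Ideal.span (Set.range
      (sylvesterMinors (X 0 ^ m) (X 1 ^ m) (X 1 ^ (m - n)) p q q'))) :
    F ∈ Ideal.span (Set.range
      (sylvesterMinors (X 0 ^ m) (X 1 ^ m) (X 1 ^ (m - n)) p q q')) := by
  have hb : (X 1 ^ m : MvPolynomial (Fin 3) k) = X 1 ^ (m - n) * X 1 ^ n := by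
    rw [← pow_add, Nat.sub_add_cancel hnm]
  have hm : m ≠ 0 := by omega
  have hcross : crossProduct
      (MvPolynomial.map setXZero ∘ ![(X 0 : MvPolynomial (Fin 3) (MvPolynomial (Fin 3) k)),
        linearForm q, C (-X 1 ^ n)])
      (MvPolynomial.map setXZero ∘ ![X 1 * C (X 1 ^ (m - n)), linearForm q', C (X 0 ^ m)]) =
      sylvesterMinors 0 (X 1 ^ m) (X 1 ^ (m - n)) (setXZero ∘ p) (setXZero ∘ q)
        (setXZero ∘ q') := by
    have hp' : ∀ i, (setXZero ∘ p) i = (setXZero ∘ q) i * 0 + (setXZero ∘ q') i * X 1 ^ n := by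
      intro i
      simp [hp, setXZero_X, hm]
    rw [← cross_columns hp' hb, comp_vecCons_three, comp_vecCons_three]
    simp only [map_linearForm, map_mul, map_X, map_C, map_pow, map_neg, setXZero_X,
      Matrix.cons_val, zero_pow hm, map_zero]
  have hprime := exists_not_dvd_sylvesterMinors_setXZero hn hnm hcop hsyl
  rw [← cross_columns hp hb] at hF ⊢
  refine mem_span_cross_of_mul_mem (MvPolynomial.map setXZero) (ξ := C (X 0)) (by simp)
    (by simp [setXZero_X]) C_X_dvd_sub_map_setXZero ?_ ?_ hF
  · rw [hcross]
    intro h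
    obtain ⟨i, hi⟩ := hprime (X 0) X_prime
    exact hi (by simp [h])
  · rwa [hcross]

end Reduction

section Main

lemma isHomogeneous_not_isUnit {σ k : Type*} [Field k] {d : ℕ} (hd : d ≠ 0) {f : MvPolynomial σ k}
    (hf : f.IsHomogeneous d) : ¬ IsUnit f := by
  intro h
  have h0 : constantCoeff f ≠ 0 := (h.map constantCoeff).ne_zero
  refine h0 ?_
  rw [constantCoeff_eq]
  exact hf.coeff_eq_zero (by simpa using hd.symm)

lemma minorsIdeal_one_le_span {A : Type*} [CommRing A] (a b : A) (p : Fin 3 → A) :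
    minorsIdeal 1 !![a, p 0; b, p 1; 0, p 2] ≤ Ideal.span ({a, b} ∪ Set.range p) := by
  refine Ideal.span_le.mpr ?_
  rintro _ ⟨r, c, -, -, rfl⟩
  rw [det_fin_one, submatrix_apply]
  have hp (i : Fin 3) : p i ∈ Ideal.span ({a, b} ∪ Set.range p) :=
    Ideal.subset_span (.inr ⟨i, rfl⟩)
  generalize r 0 = i
  generalize c 0 = j
  fin_cases j
  · fin_cases i
    · exact Ideal.subset_span (by simp)
    · exact Ideal.subset_span (by simp)
    · exact Ideal.zero_mem _
  · fin_cases i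
    exacts [hp 0, hp 1, hp 2]

lemma mem_minorsIdeal_one {A : Type*} [CommRing A] {s t : ℕ} (M : Matrix (Fin s) (Fin t) A)
    (i : Fin s) (j : Fin t) : M i j ∈ minorsIdeal 1 M :=
  Ideal.subset_span ⟨fun _ => i, fun _ => j, Function.injective_of_subsingleton _,
    Function.injective_of_subsingleton _, by simp⟩

lemma signedMinors_eq {A : Type*} [CommRing A] (a b : A) (p : Fin 3 → A) :
    (fun i : Fin 3 => (-1) ^ (i : ℕ) *
      ((!![a, p 0; b, p 1; 0, p 2] : Matrix (Fin 3) (Fin 2) A).submatrix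
        (Fin.succAbove i) id).det) = signedMinors a b p := by
  ext i
  fin_cases i <;> simp [signedMinors, det_fin_two, Fin.succAbove]
  ring

universe u

/-- The presentation ideal of the Rees algebra as an ideal of minors, together with the
Cohen–Macaulay property of the Rees algebra. -/
lemma ker_reesPresentation_signedMinors {k : Type u} [Field k] {m n ε : ℕ} (hn : 1 ≤ n)
    (hnm : n ≤ m) (hε : 1 ≤ ε) {p q q' : Fin 3 → MvPolynomial (Fin 3) k}
    (hpdeg : ∀ i, (p i).IsHomogeneous (n + ε))
    (hI : idealHeight (minorsIdeal 2 !![(X 0 : MvPolynomial (Fin 3) k) ^ m, p 0;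
      (X 1 : MvPolynomial (Fin 3) k) ^ m, p 1; 0, p 2]) = 2)
    (hcomp : ∃ u, u ∉ axisIdeal k ∧
      u * X 1 ^ n ∈ minorsIdeal 1 !![(X 0 : MvPolynomial (Fin 3) k) ^ m, p 0;
        (X 1 : MvPolynomial (Fin 3) k) ^ m, p 1; 0, p 2])
    (hz : m = n → degreeOf 2 (X 0 ^ m * p 1 - X 1 ^ m * p 0) = ε ∨ degreeOf 2 (p 2) = ε)
    (hp : ∀ i, p i = q i * X 0 ^ m + q' i * X 1 ^ n) :
    RingHom.ker (reesPresentation (signedMinors (X 0 ^ m) (X 1 ^ m) p)) =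
      Ideal.span (Set.range (sylvesterMinors (X 0 ^ m) (X 1 ^ m) (X 1 ^ (m - n)) p q q')) ∧
    (RingHom.ker (reesPresentation (signedMinors (X 0 ^ m) (X 1 ^ m) p))).height = 2 ∧
    IsCohenMacaulayRing (MvPolynomial (Fin 3) (MvPolynomial (Fin 3) k) ⧸
      RingHom.ker (reesPresentation (signedMinors (X 0 ^ m) (X 1 ^ m) p))) := by
  have hb : (X 1 ^ m : MvPolynomial (Fin 3) k) = X 1 ^ (m - n) * X 1 ^ n := by
    rw [← pow_add, Nat.sub_add_cancel hnm]
  have hcop : ∀ π, Prime π → π ∣ X 0 ^ m * p 1 - X 1 ^ m * p 0 → ¬ π ∣ p 2 := by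
    intro π hπ h1 h2
    refine not_le_span_singleton_of_two_le_idealHeight hI.ge hπ ?_
    rw [minorsIdeal_two_eq_span_cross, Ideal.span_le]
    rintro _ ⟨i, rfl⟩
    rw [SetLike.mem_coe, Ideal.mem_span_singleton, cross_apply]
    fin_cases i
    · simpa using h2.mul_left _
    · simpa using h2.mul_left _
    · simpa using h1
  have hDdeg : (X 0 ^ m * p 1 - X 1 ^ m * p 0 : MvPolynomial (Fin 3) k).IsHomogeneous
      (m + (n + ε)) :=
    ((isHomogeneous_X_pow 0 m).mul (hpdeg 1)).sub ((isHomogeneous_X_pow 1 m).mul (hpdeg 0))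
  have hD : X 0 ^ m * p 1 - X 1 ^ m * p 0 ≠ 0 :=
    ne_zero_of_no_common_prime (X_prime (i := 0)) hcop
      (isHomogeneous_not_isUnit (by omega) (hpdeg 2))
  have hp2 : p 2 ≠ 0 :=
    ne_zero_of_no_common_prime (X_prime (i := 0)) (fun π hπ h1 h2 => hcop π hπ h2 h1)
      (isHomogeneous_not_isUnit (by omega) hDdeg)
  have hx : (X 0 ^ m : MvPolynomial (Fin 3) k) ≠ 0 := pow_ne_zero _ (X_ne_zero 0)
  have hsyl := sylvesterForm_notMem_map_C hn hnm hε hpdeg hp (minorsIdeal_one_le_span _ _ _)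
    hcomp hz
  have hker := ker_reesPresentation_eq_span (X_ne_zero 0) hp hb hD hcop
    (fun _ => C_X_mul_mem_span_sylvesterMinors hn hnm hp hcop hsyl)
  have hheight := height_ker_reesPresentation hx hp2 hD hcop
  refine ⟨hker, hheight, ?_⟩
  have hprime (π) (hπ : Prime π) :
      ∃ i, ¬ π ∣ sylvesterMinors (X 0 ^ m) (X 1 ^ m) (X 1 ^ (m - n)) p q q' i := by
    by_contra! h
    have : RingHom.ker (reesPresentation (signedMinors (X 0 ^ m) (X 1 ^ m) p)) ≤
        Ideal.span {π} := by
      rw [hker, Ideal.span_le]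
      rintro _ ⟨i, rfl⟩
      exact Ideal.mem_span_singleton.mpr (h i)
    have := (hheight.ge.trans (Ideal.height_mono this)).trans
      (Ideal.height_span_singleton_le_one hπ.not_isUnit)
    norm_num at this
  have hB : HasLongRegularSequences (MvPolynomial (Fin 3) (MvPolynomial (Fin 3) k)) (4 + 2) :=
    ((hasLongRegularSequences_zero k).mvPolynomial 3).mvPolynomial 3
  rw [← cross_columns hp hb] at hprime hker
  have hquot := hB.quotient_span_cross (fun h => by
    obtain ⟨i, hi⟩ := hprime (X 0) X_prime
    exact hi (by rw [h]; exact dvd_zero _)) hprime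
  rw [← hker] at hquot
  refine hquot.isCohenMacaulayRing ?_
  have hdim := ringKrullDim_quotient_add_two_le (b := X 1 ^ m) hx hp2
  rw [MvPolynomial.ringKrullDim_of_isNoetherianRing, MvPolynomial.ringKrullDim_of_isNoetherianRing,
    ringKrullDim_eq_zero_of_field] at hdim
  refine ENat.WithBot.add_le_add_natCast_right_iff (c := 2).mp ?_
  rw [Nat.card_fin, zero_add] at hdim
  exact_mod_cast hdim

end Main

/-- Let `R = k[x,y,z]` and `φ` the `3×2` matrix with columns
`(x^m, y^m, 0)ᵗ` and `(p₁, p₂, p₃)ᵗ` subject to hypotheses (a)–(d).  Then the Rees algebra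
of `I = I₂(φ)` is Cohen–Macaulay and, writing `pᵢ = qᵢx^m + q'ᵢyⁿ`, its bihomogeneous
defining ideal in `R[t₁,t₂,t₃]` is the prime height-2 ideal of `2`-minors of the `3×2`
matrix with rows `(t₁, t₂y^{m−n})`, `(Σqᵢtᵢ, Σq'ᵢtᵢ)`, `(−yⁿ, x^m)` (generated by the two
symmetric-algebra relations together with one Sylvester form of bidegree `(ε,2)`). -/
theorem statement10 {k : Type*} [Field k] {m n ε : ℕ}
    (hn : 1 ≤ n) (hnm : n ≤ m) (hε : max (m - n) 1 ≤ ε)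
    (p : Fin 3 → MvPolynomial (Fin 3) k)
    (hpdeg : ∀ i, (p i).IsHomogeneous (n + ε))
    (φ : Matrix (Fin 3) (Fin 2) (MvPolynomial (Fin 3) k))
    (hφ : φ = !![(MvPolynomial.X 0 : MvPolynomial (Fin 3) k) ^ m, p 0;
                 (MvPolynomial.X 1 : MvPolynomial (Fin 3) k) ^ m, p 1;
                 0, p 2])
    (hI : idealHeight (minorsIdeal 2 φ) = 2)
    (hprimary : ∀ r : MvPolynomial (Fin 3) k,
      (∃ u, u ∉ Ideal.span ({MvPolynomial.X 0, MvPolynomial.X 1} :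
          Set (MvPolynomial (Fin 3) k)) ∧ u * r ∈ minorsIdeal 1 φ) ↔
        r ∈ Ideal.span ({MvPolynomial.X 0 ^ m, MvPolynomial.X 1 ^ n} :
          Set (MvPolynomial (Fin 3) k)))
    (hz : m = n →
      MvPolynomial.degreeOf 2
          ((MvPolynomial.X 0 : MvPolynomial (Fin 3) k) ^ m * p 1 -
            (MvPolynomial.X 1 : MvPolynomial (Fin 3) k) ^ m * p 0) = ε ∨
        MvPolynomial.degreeOf 2 (p 2) = ε)
    (Δ : Fin 3 → MvPolynomial (Fin 3) k)
    (hΔ : Δ = fun i : Fin 3 => (-1) ^ (i : ℕ) * (φ.submatrix (Fin.succAbove i) id).det) :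
    IsCohenMacaulayRing
      (MvPolynomial (Fin 3) (MvPolynomial (Fin 3) k) ⧸ RingHom.ker (reesPresentation Δ)) ∧
    ∀ (q q' : Fin 3 → MvPolynomial (Fin 3) k)
      (W : Matrix (Fin 3) (Fin 2) (MvPolynomial (Fin 3) (MvPolynomial (Fin 3) k))),
      (∀ i, p i = q i * MvPolynomial.X 0 ^ m + q' i * MvPolynomial.X 1 ^ n) →
      W = !![MvPolynomial.X 0,
               MvPolynomial.X 1 * MvPolynomial.C (MvPolynomial.X 1 ^ (m - n));
             ∑ i : Fin 3, MvPolynomial.C (q i) * MvPolynomial.X i,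
               ∑ i : Fin 3, MvPolynomial.C (q' i) * MvPolynomial.X i;
             MvPolynomial.C (-((MvPolynomial.X 1 : MvPolynomial (Fin 3) k) ^ n)),
               MvPolynomial.C (MvPolynomial.X 0 ^ m)] →
      RingHom.ker (reesPresentation Δ) = minorsIdeal 2 W ∧
        (minorsIdeal 2 W).IsPrime ∧ idealHeight (minorsIdeal 2 W) = 2 := by
  subst hφ hΔ
  rw [signedMinors_eq]
  have hε' : 1 ≤ ε := (le_max_right _ _).trans hε
  have hcomp := (hprimary (X 1 ^ n)).mpr (Ideal.subset_span (by simp))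
  have key := fun {q q' : Fin 3 → MvPolynomial (Fin 3) k} =>
    ker_reesPresentation_signedMinors (q := q) (q' := q') hn hnm hε' hpdeg hI hcomp hz
  constructor
  · have hq (i : Fin 3) : ∃ u v, p i = u * X 0 ^ m + v * X 1 ^ n := by
      have hpi : p i ∈ minorsIdeal 1 !![(X 0 : MvPolynomial (Fin 3) k) ^ m, p 0;
          (X 1 : MvPolynomial (Fin 3) k) ^ m, p 1; 0, p 2] := by
        convert mem_minorsIdeal_one _ i 1 using 1
        fin_cases i <;> rfl
      obtain ⟨u, v, h⟩ := Ideal.mem_span_pair.mp ((hprimary (p i)).mp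
        ⟨1, one_notMem_axis, by rwa [one_mul]⟩)
      exact ⟨u, v, h.symm⟩
    choose q q' hq using hq
    exact (key hq).2.2
  · rintro q q' W hp rfl
    obtain ⟨hker, hheight, -⟩ := key hp
    have hW : RingHom.ker (reesPresentation (signedMinors (X 0 ^ m) (X 1 ^ m) p)) =
        minorsIdeal 2 !![(X 0 : MvPolynomial (Fin 3) (MvPolynomial (Fin 3) k)),
            X 1 * C (X 1 ^ (m - n));
          ∑ i : Fin 3, C (q i) * X i, ∑ i : Fin 3, C (q' i) * X i;
          C (-(X 1 ^ n)), C (X 0 ^ m)] := by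
      rw [hker, minorsIdeal_two_eq_span_cross, ← cross_columns hp
        (by rw [← pow_add, Nat.sub_add_cancel hnm])]
      congr 3
      all_goals
        ext1 i
        fin_cases i <;> rfl
    rw [← hW]
    have hprime : (RingHom.ker (reesPresentation
        (signedMinors ((X 0 : MvPolynomial (Fin 3) k) ^ m) (X 1 ^ m) p))).IsPrime :=
      RingHom.ker_isPrime _
    exact ⟨rfl, hprime, (idealHeight_eq_height _).trans hheight⟩
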